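/- Let m₁ > 0, m₂ > 1, and M > m₂√2 be real numbers. Then for all x ≥ 0, (1 + (x+1) m₁ M (x + m₂)^{M−1})² > 2 (m₁² (x + m₂)^{2M} − 2(x+1)). -/

import Mathlib

/-- The elementary bound `2(x + m)² < M²(x+1)²` behind the discriminant estimate. -/
theorem two_mul_add_sq_lt {m M x : ℝ} (hm : 1 < m) (hM : m * Real.sqrt 2 < M) (hx : 0 ≤ x) :
    2 * (x + m) ^ 2 < (M * (x + 1)) ^ 2 := by
  have hlt : Real.sqrt 2 * (x + m) < M * (x + 1) :=
    calc Real.sqrt 2 * (x + m) ≤ Real.sqrt 2 * (m * (x + 1)) := by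
          gcongr
          nlinarith
      _ = m * Real.sqrt 2 * (x + 1) := by ring
      _ < M * (x + 1) := by gcongr
  calc 2 * (x + m) ^ 2 = (Real.sqrt 2 * (x + m)) ^ 2 := by
        rw [mul_pow, Real.sq_sqrt zero_le_two]
    _ < (M * (x + 1)) ^ 2 := by gcongr

/-- Key discriminant estimate in the exponential case:
`(1 + (x+1)m'(x))² > 2(m(x)² − 2(x+1))` with `m(x) = m₁(x+m₂)^M`. -/
theorem discriminant_estimate_exp
    (m₁ m₂ M : ℝ)
    (hm₁ : 0 < m₁)
    (hm₂ : 1 < m₂)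
    (hM : M > m₂ * Real.sqrt 2) :
    ∀ x : ℝ, 0 ≤ x →
      (1 + (x + 1) * (m₁ * M * (x + m₂) ^ (M - 1))) ^ 2
        > 2 * (m₁ ^ 2 * (x + m₂) ^ (2 * M) - 2 * (x + 1)) := by
  intro x hx
  have hy : 0 < x + m₂ := by linarith
  have hM₀ : 0 < M := lt_of_le_of_lt (by positivity) hM
  have hpow : (x + m₂) ^ (2 * M) = ((x + m₂) ^ (M - 1)) ^ 2 * (x + m₂) ^ 2 := by
    rw [← mul_pow, ← Real.rpow_add_one hy.ne', sub_add_cancel, mul_comm 2 M,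
      Real.rpow_mul hy.le, Real.rpow_two]
  rw [hpow]
  have hp : 0 < (x + m₂) ^ (M - 1) := Real.rpow_pos_of_pos hy _
  generalize (x + m₂) ^ (M - 1) = p at hp ⊢
  have hmain := mul_lt_mul_of_pos_left (two_mul_add_sq_lt hm₂ hM hx)
    (show 0 < (m₁ * p) ^ 2 by positivity)
  have hcross : 0 < (x + 1) * (m₁ * M * p) := by positivity
  linarith
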